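/- arXiv:2211.08196 — 2 statements merged into one kernel-verified Lean document; each statement's English description precedes it below -/
import Mathlib

section
/- Let ψ be a ℂ-algebra automorphism of the group algebra ℂ[G] = ℂ[X ⋊ W] that fixes every element of the subalgebra ℂ[X]. Then for every w ∈ W there exists a unit u_w of the commutative ring ℂ[X] such that ψ(w) = u_w · w in ℂ[G]. -/
lemma aux_centralizer {X W : Type*} [CommGroup X]
    [Module.Free ℤ (Additive X)] [Group W]
    (φ : W →* MulAut X) (hfaith : Function.Injective φ)
    (f : MonoidAlgebra ℂ (X ⋊[φ] W))
    (hf : ∀ x : X, f * MonoidAlgebra.of ℂ (X ⋊[φ] W) (SemidirectProduct.inl x)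
      = MonoidAlgebra.of ℂ (X ⋊[φ] W) (SemidirectProduct.inl x) * f) :
    ∃ a : MonoidAlgebra ℂ X,
      MonoidAlgebra.mapDomainAlgHom ℂ ℂ (SemidirectProduct.inl : X →* X ⋊[φ] W) a = f := by
  refine ⟨MonoidAlgebra.comapDomain (SemidirectProduct.inl : X →* X ⋊[φ] W)
    SemidirectProduct.inl_injective f, ?_⟩
  refine MonoidAlgebra.mapDomain_comapDomain ?_ SemidirectProduct.inl_injective
  intro g hg
  have hconj : ∀ x : X, ∀ g : X ⋊[φ] W,
      f.coeff (SemidirectProduct.inl x * g * (SemidirectProduct.inl x)⁻¹) = f.coeff g := by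
    intro x g
    have h := congrArg (fun p => p.coeff (SemidirectProduct.inl x * g)) (hf x)
    simpa [MonoidAlgebra.of_apply] using h
  by_cases hr : g.right = 1
  · refine ⟨g.left, ?_⟩
    ext <;> simp [hr]
  exfalso
  have hne : φ g.right ≠ 1 := fun h => hr (hfaith (by rw [h, map_one]))
  obtain ⟨x, hx⟩ : ∃ x, φ g.right x ≠ x := by
    by_contra! h
    exact hne (by ext x; simpa using h x)
  have hz : x * (φ g.right x)⁻¹ ≠ 1 := fun h => hx (mul_inv_eq_one.mp h).symm
  have hT : Module.IsTorsionFree ℤ (Additive X) := inferInstance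
  have : Function.Injective (fun n : ℕ =>
      (SemidirectProduct.inl (x ^ n) * g * (SemidirectProduct.inl (x ^ n))⁻¹ : X ⋊[φ] W)) := by
    intro m n hmn
    have h := congrArg SemidirectProduct.left hmn
    have h2 : ∀ k : ℕ, (SemidirectProduct.inl (x ^ k) * g *
        (SemidirectProduct.inl (x ^ k))⁻¹ : X ⋊[φ] W).left
        = (x * (φ g.right x)⁻¹) ^ k * g.left := by
      intro k
      rw [mul_pow, inv_pow, ← map_pow]
      generalize x ^ k = y
      simp [mul_right_comm]
    simp only [h2, mul_left_inj] at h
    have h3 : (m : ℤ) • Additive.ofMul (x * (φ g.right x)⁻¹)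
        = (n : ℤ) • Additive.ofMul (x * (φ g.right x)⁻¹) := by
      rw [natCast_zsmul, natCast_zsmul, ← ofMul_pow, ← ofMul_pow, h]
    have h4 : Additive.ofMul (x * (φ g.right x)⁻¹) ≠ 0 := fun h0 => hz h0
    exact_mod_cast smul_left_injective ℤ h4 h3
  refine Set.infinite_of_injective_forall_mem this (s := (f.coeff.support : Set _)) ?_
    (Finset.finite_toSet _)
  intro n
  simp only [Finset.mem_coe, Finsupp.mem_support_iff] at hg ⊢
  rwa [hconj]

/-- Let `X` be a finitely generated free abelian group (written
multiplicatively), `W` a finite group acting faithfully on `X` by automorphisms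
(via `φ : W →* MulAut X`), and `G = X ⋊ W`.  If `ψ` is a `ℂ`-algebra automorphism of
the group algebra `ℂ[G]` fixing every element of the subalgebra `ℂ[X]`, then for every
`w ∈ W` there is a unit `u` of `ℂ[X]` with `ψ(w) = u · w` in `ℂ[G]`. -/
theorem stmt_4 {X W : Type*} [CommGroup X]
    [Module.Free ℤ (Additive X)] [Module.Finite ℤ (Additive X)]
    [Group W] [Fintype W]
    (φ : W →* MulAut X) (hfaith : Function.Injective φ)
    (ψ : MonoidAlgebra ℂ (X ⋊[φ] W) ≃ₐ[ℂ] MonoidAlgebra ℂ (X ⋊[φ] W))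
    (hψ : ∀ a : MonoidAlgebra ℂ X,
      ψ (MonoidAlgebra.mapDomainAlgHom ℂ ℂ (SemidirectProduct.inl : X →* X ⋊[φ] W) a)
        = MonoidAlgebra.mapDomainAlgHom ℂ ℂ (SemidirectProduct.inl : X →* X ⋊[φ] W) a) :
    ∀ w : W, ∃ u : (MonoidAlgebra ℂ X)ˣ,
      ψ (MonoidAlgebra.of ℂ (X ⋊[φ] W) (SemidirectProduct.inr w))
        = MonoidAlgebra.mapDomainAlgHom ℂ ℂ (SemidirectProduct.inl : X →* X ⋊[φ] W)
            (u : MonoidAlgebra ℂ X)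
          * MonoidAlgebra.of ℂ (X ⋊[φ] W) (SemidirectProduct.inr w) := by
  intro w
  set ι := MonoidAlgebra.mapDomainAlgHom ℂ ℂ (SemidirectProduct.inl : X →* X ⋊[φ] W) with hι
  let T : X ⋊[φ] W →* MonoidAlgebra ℂ (X ⋊[φ] W) := MonoidAlgebra.of ℂ (X ⋊[φ] W)
  have hinj : Function.Injective ι :=
    MonoidAlgebra.mapDomain_injective SemidirectProduct.inl_injective
  have hx : ∀ x : X, ψ (T (SemidirectProduct.inl x)) = T (SemidirectProduct.inl x) := by
    intro x
    have h := hψ (MonoidAlgebra.of ℂ X x)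
    have h2 : ι (MonoidAlgebra.of ℂ X x) = T (SemidirectProduct.inl x) := by
      simp [hι, T, MonoidAlgebra.of_apply]
    rwa [h2] at h
  -- the candidate element and its inverse
  let r : X ⋊[φ] W := SemidirectProduct.inr w
  have hrr : T r * T r⁻¹ = 1 := by rw [← map_mul]; simp
  have hrr' : T r⁻¹ * T r = 1 := by rw [← map_mul]; simp
  have hpp : ψ (T r) * ψ (T r⁻¹) = 1 := by rw [← map_mul, hrr, map_one]
  have hpp' : ψ (T r⁻¹) * ψ (T r) = 1 := by rw [← map_mul, hrr', map_one]
  have h1 : ∀ x : X, T r⁻¹ * T (SemidirectProduct.inl x)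
      = T (SemidirectProduct.inl (φ w⁻¹ x)) * T r⁻¹ := by
    intro x
    rw [← map_mul, ← map_mul]
    congr 1
    ext <;> simp [r]
  have h2 : ∀ x : X, T r * T (SemidirectProduct.inl (φ w⁻¹ x))
      = T (SemidirectProduct.inl x) * T r := by
    intro x
    rw [← map_mul, ← map_mul]
    congr 1
    ext <;> simp [r]
  have h1' : ∀ x : X, ψ (T r⁻¹) * T (SemidirectProduct.inl x)
      = T (SemidirectProduct.inl (φ w⁻¹ x)) * ψ (T r⁻¹) := by
    intro x
    have h := congrArg ψ (h1 x)
    rwa [map_mul, map_mul, hx, hx] at h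
  have h2' : ∀ x : X, ψ (T r) * T (SemidirectProduct.inl (φ w⁻¹ x))
      = T (SemidirectProduct.inl x) * ψ (T r) := by
    intro x
    have h := congrArg ψ (h2 x)
    rwa [map_mul, map_mul, hx, hx] at h
  obtain ⟨a, ha⟩ := aux_centralizer φ hfaith (ψ (T r) * T r⁻¹) (by
    intro x
    change _ * T _ = T _ * _
    rw [mul_assoc, h1, ← mul_assoc, h2', mul_assoc])
  obtain ⟨b, hb⟩ := aux_centralizer φ hfaith (T r * ψ (T r⁻¹)) (by
    intro x
    change _ * T _ = T _ * _
    rw [mul_assoc, h1', ← mul_assoc, h2, mul_assoc])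
  have hab : a * b = 1 := by
    apply hinj
    rw [map_mul, map_one, hι, ha, hb, mul_assoc, ← mul_assoc (T r⁻¹), hrr', one_mul, hpp]
  refine ⟨⟨a, b, hab, by rw [mul_comm, hab]⟩, ?_⟩
  change ψ (T r) = ι a * T r
  rw [hι, ha, mul_assoc, hrr', mul_one]
end

section
/- Every unit of the complex group algebra ℂ[X] of a finitely generated free abelian group X is trivial: if u ∈ ℂ[X] is invertible, then there exist z ∈ ℂˣ and x ∈ X such that u = z·x (a nonzero scalar multiple of a single group element). -/
/-- Every unit of the complex group algebra `ℂ[X]` of a finitely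
generated free abelian group `X` (written multiplicatively) is trivial: it is a nonzero
scalar multiple of a single group element. -/
theorem stmt_5 {X : Type*} [CommGroup X]
    [Module.Free ℤ (Additive X)] [Module.Finite ℤ (Additive X)]
    (u : (MonoidAlgebra ℂ X)ˣ) :
    ∃ (z : ℂˣ) (x : X),
      (u : MonoidAlgebra ℂ X) = (z : ℂ) • MonoidAlgebra.of ℂ X x := by
  have hs : TwoUniqueSums (Additive X) :=
    TwoUniqueSums.of_injective_addHom
      ⟨fun x => (Module.Free.chooseBasis ℤ (Additive X)).repr x, fun _ _ => map_add _ _ _⟩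
      (Module.Free.chooseBasis ℤ (Additive X)).repr.injective inferInstance
  have hX : TwoUniqueProds X :=
    TwoUniqueProds.of_injective_mulHom
      (G := Multiplicative (Additive X)) ⟨fun x => Multiplicative.ofAdd (Additive.ofMul x),
        fun _ _ => rfl⟩ (fun _ _ h => h) inferInstance
  obtain ⟨u, v, huv, hvu⟩ := u
  change ∃ (z : ℂˣ) (x : X), u = (z : ℂ) • MonoidAlgebra.of ℂ X x
  have key : ∀ a b : X, a ∈ u.coeff.support → b ∈ v.coeff.support →
      UniqueMul u.coeff.support v.coeff.support a b → a * b = 1 := by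
    intro a b ha hb h
    have h1 := MonoidAlgebra.coeff_mul_mul_of_uniqueMul h
    by_contra hne
    rw [huv, MonoidAlgebra.one_def, MonoidAlgebra.coeff_single,
      Finsupp.single_eq_of_ne hne] at h1
    exact mul_ne_zero (Finsupp.mem_support_iff.mp ha) (Finsupp.mem_support_iff.mp hb) h1.symm
  have hu : u ≠ 0 := by rintro rfl; simp at huv
  have hv : v ≠ 0 := by rintro rfl; simp at huv
  have hA : 0 < u.coeff.support.card := by
    rw [Finset.card_pos, Finsupp.support_nonempty_iff]; simpa using hu
  have hB : 0 < v.coeff.support.card := by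
    rw [Finset.card_pos, Finsupp.support_nonempty_iff]; simpa using hv
  have hle : ¬ 1 < u.coeff.support.card * v.coeff.support.card := by
    intro hlt
    obtain ⟨p, hp, q, hq, hne, h1, h2⟩ := TwoUniqueProds.uniqueMul_of_one_lt_card hlt
    rw [Finset.mem_product] at hp hq
    have e1 := key _ _ hp.1 hp.2 h1
    have e2 := key _ _ hq.1 hq.2 h2
    have := h2 hp.1 hp.2 (e1.trans e2.symm)
    exact hne (Prod.ext this.1 this.2)
  have hc : u.coeff.support.card = 1 := by nlinarith
  obtain ⟨x, hx, he⟩ := Finsupp.card_support_eq_one.mp hc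
  refine ⟨Units.mk0 _ hx, x, ?_⟩
  apply MonoidAlgebra.coeff_injective
  refine he.trans ?_
  simp
end
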